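/- For every choice, for each i ∈ I, of a subset S_i of the four frame-condition/axiom pairs {(NEC_i, □_i⊤), (CONEC_i, ¬□_i⊤), (P_i, ¬□_i⊥), (COP_i, □_i⊥)}, the Hilbert system obtained by adding to the base logic, for each i ∈ I, the axioms corresponding to the pairs in S_i is sound and strongly complete with respect to the class of all models that satisfy, for each i ∈ I, the frame conditions corresponding to the pairs in S_i. -/

import Mathlib

attribute [local instance] Classical.propDecidable

/-- Formulas of the multi-modal language 𝔏: atoms, ⊥, ¬, ∨, and □_G for
finite nonempty G ⊆ I. -/
inductive Form (I : Type) : Type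
  | atom : ℕ → Form I
  | bot  : Form I
  | neg  : Form I → Form I
  | or   : Form I → Form I → Form I
  | box  : (G : Finset I) → G.Nonempty → Form I → Form I

namespace Form
variable {I : Type}
/-- φ ∧ ψ -/
def and (φ ψ : Form I) : Form I := .neg (.or (.neg φ) (.neg ψ))
/-- φ → ψ -/
def imp (φ ψ : Form I) : Form I := .or (.neg φ) ψ
/-- ⊤ -/
def top : Form I := .neg .bot
/-- φ ↔ ψ -/
def iff (φ ψ : Form I) : Form I := (φ.imp ψ).and (ψ.imp φ)
end Form

/-- The pointwise-intersection neighbourhood function: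
`N_G(w) = { ⋂_{i∈G} X_i : X_i ∈ N_i(w) }`. -/
def ptwInter {I W : Type} (N : I → W → Set (Set W)) (G : Finset I) (w : W) :
    Set (Set W) :=
  { X | ∃ Y : I → Set W, (∀ i ∈ G, Y i ∈ N i w) ∧ X = ⋂ i ∈ G, Y i }

/-- Satisfaction at a world, relative to neighbourhood functions `N` and a
valuation `V`. -/
def satN {I W : Type} (N : I → W → Set (Set W)) (V : ℕ → Set W) :
    Form I → W → Prop
  | .atom n, w => w ∈ V n
  | .bot, _ => False
  | .neg φ, w => ¬ satN N V φ w
  | .or φ ψ, w => satN N V φ w ∨ satN N V ψ w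
  | .box G _ φ, w => { v | satN N V φ v } ∈ ptwInter N G w

/-- A neighbourhood model. -/
structure NbhModel (I : Type) where
  W : Type
  ne : Nonempty W
  N : I → W → Set (Set W)
  V : ℕ → Set W

/-- Truth in a model. -/
def NbhModel.sat {I : Type} (M : NbhModel I) (w : M.W) (φ : Form I) : Prop :=
  satN M.N M.V φ w

/-- Propositional evaluation treating atoms and boxed formulas as atomic. -/
def evalP {I : Type} (v : Form I → Prop) : Form I → Prop
  | .atom n => v (.atom n)
  | .bot => False
  | .neg φ => ¬ evalP v φ
  | .or φ ψ => evalP v φ ∨ evalP v ψ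
  | .box G h φ => v (.box G h φ)

/-- Classical propositional tautologies (in the extended modal language). -/
def Tautology {I : Type} (φ : Form I) : Prop := ∀ v, evalP v φ

theorem unionNE {I : Type} [DecidableEq I] {G H : Finset I}
    (hG : G.Nonempty) : (G ∪ H).Nonempty :=
  hG.mono Finset.subset_union_left

/-- Axiom schema B1: `(□_Gφ ∧ □_Hψ) → □_{G∪H}(φ∧ψ)` for disjoint G, H. -/
def B1Ax (I : Type) [DecidableEq I] : Set (Form I) :=
  { χ | ∃ (G H : Finset I) (hG : G.Nonempty) (hH : H.Nonempty) (φ ψ : Form I),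
      Disjoint G H ∧
      χ = ((Form.box G hG φ).and (Form.box H hH ψ)).imp
            (Form.box (G ∪ H) (unionNE hG) (φ.and ψ)) }

/-- Axiom schema B2: `□_{G∪H}⊤ → □_G⊤`. -/
def B2Ax (I : Type) [DecidableEq I] : Set (Form I) :=
  { χ | ∃ (G H : Finset I) (hG : G.Nonempty) (_hH : H.Nonempty),
      χ = (Form.box (G ∪ H) (unionNE hG) Form.top).imp (Form.box G hG Form.top) }

/-- Axiom schema B3: `(□_Gφ ∧ □_{G∪H∪J}φ) → □_{G∪H}φ`. -/
def B3Ax (I : Type) [DecidableEq I] : Set (Form I) :=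
  { χ | ∃ (G H J : Finset I) (hG : G.Nonempty) (_hH : H.Nonempty)
      (_hJ : J.Nonempty) (φ : Form I),
      χ = ((Form.box G hG φ).and (Form.box (G ∪ H ∪ J) (unionNE (unionNE hG)) φ)).imp
            (Form.box (G ∪ H) (unionNE hG) φ) }

/-- Axiom schema B4: `(□_Gφ ∧ □_H(φ∨ψ)) → □_{G∪H}φ`. -/
def B4Ax (I : Type) [DecidableEq I] : Set (Form I) :=
  { χ | ∃ (G H : Finset I) (hG : G.Nonempty) (hH : H.Nonempty) (φ ψ : Form I),
      χ = ((Form.box G hG φ).and (Form.box H hH (φ.or ψ))).imp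
            (Form.box (G ∪ H) (unionNE hG) φ) }

/-- The axioms of the base logic. -/
def BaseAx (I : Type) [DecidableEq I] : Set (Form I) :=
  B1Ax I ∪ B2Ax I ∪ B3Ax I ∪ B4Ax I

/-- Hilbert-style provability from classical tautologies and the axioms in
`Ax`, closed under modus ponens and replacement of equivalents. -/
inductive Prv {I : Type} (Ax : Set (Form I)) : Form I → Prop
  | taut {φ : Form I} : Tautology φ → Prv Ax φ
  | ax {φ : Form I} : φ ∈ Ax → Prv Ax φ
  | mp {φ ψ : Form I} : Prv Ax (φ.imp ψ) → Prv Ax φ → Prv Ax ψ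
  | re {φ ψ : Form I} (G : Finset I) (hG : G.Nonempty) :
      Prv Ax (φ.iff ψ) → Prv Ax ((Form.box G hG φ).iff (Form.box G hG ψ))

/-- `Γ ⊢ φ` iff there are `ψ₁,…,ψₙ ∈ Γ` with `⊢ (ψ₁∧…∧ψₙ) → φ`. -/
def Deduces {I : Type} (Ax : Set (Form I)) (Γ : Set (Form I)) (φ : Form I) :
    Prop :=
  ∃ l : List (Form I), (∀ ψ ∈ l, ψ ∈ Γ) ∧
    Prv Ax ((l.foldr Form.and Form.top).imp φ)

/-- Semantic consequence over a class of models. -/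
def SemConseq {I : Type} (C : NbhModel I → Prop) (Γ : Set (Form I))
    (φ : Form I) : Prop :=
  ∀ M : NbhModel I, C M → ∀ w : M.W, (∀ ψ ∈ Γ, M.sat w ψ) → M.sat w φ

/-- Soundness and strong completeness of `Ax` w.r.t. the class `C`. -/
def SoundComplete {I : Type} (Ax : Set (Form I)) (C : NbhModel I → Prop) :
    Prop :=
  ∀ (Γ : Set (Form I)) (φ : Form I), Deduces Ax Γ φ ↔ SemConseq C Γ φ

/-- Axioms of the cheap extensions: for each i ∈ I, the selected axioms among
□_i⊤ (NEC), ¬□_i⊤ (CONEC), ¬□_i⊥ (P), □_i⊥ (COP). -/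
def CheapAx (I : Type) [DecidableEq I] (nec conec pax cop : I → Prop) :
    Set (Form I) :=
  { χ | ∃ i : I,
      (nec i ∧ χ = Form.box {i} (Finset.singleton_nonempty i) Form.top) ∨
      (conec i ∧ χ = (Form.box {i} (Finset.singleton_nonempty i) Form.top).neg) ∨
      (pax i ∧ χ = (Form.box {i} (Finset.singleton_nonempty i) Form.bot).neg) ∨
      (cop i ∧ χ = Form.box {i} (Finset.singleton_nonempty i) Form.bot) }

/-- The corresponding frame conditions: for each i ∈ I, the selected
conditions among W ∈ N_i(w) (NEC), W ∉ N_i(w) (CONEC), ∅ ∉ N_i(w) (P),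
∅ ∈ N_i(w) (COP), quantified over all worlds w. -/
def CheapFrame {I : Type} (nec conec pax cop : I → Prop) (M : NbhModel I) :
    Prop :=
  (∀ i : I, nec i → ∀ w : M.W, Set.univ ∈ M.N i w) ∧
  (∀ i : I, conec i → ∀ w : M.W, Set.univ ∉ M.N i w) ∧
  (∀ i : I, pax i → ∀ w : M.W, (∅ : Set M.W) ∉ M.N i w) ∧
  (∀ i : I, cop i → ∀ w : M.W, (∅ : Set M.W) ∈ M.N i w)

section Propositional
variable {I : Type} (v : Form I → Prop) (φ ψ : Form I)

@[simp] theorem evalP_bot : evalP v Form.bot ↔ False := Iff.rfl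

@[simp] theorem evalP_neg : evalP v φ.neg ↔ ¬ evalP v φ := Iff.rfl

@[simp] theorem evalP_or : evalP v (φ.or ψ) ↔ evalP v φ ∨ evalP v ψ := Iff.rfl

@[simp] theorem evalP_box (G : Finset I) (hG : G.Nonempty) :
    evalP v (.box G hG φ) ↔ v (.box G hG φ) := Iff.rfl

@[simp] theorem evalP_top : evalP v Form.top := id

@[simp] theorem evalP_and : evalP v (φ.and ψ) ↔ evalP v φ ∧ evalP v ψ := by
  simp [Form.and]

@[simp] theorem evalP_imp : evalP v (φ.imp ψ) ↔ (evalP v φ → evalP v ψ) := by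
  simp [Form.imp, imp_iff_not_or]

@[simp] theorem evalP_iff : evalP v (φ.iff ψ) ↔ (evalP v φ ↔ evalP v ψ) := by
  simp [Form.iff, iff_def]

@[simp] theorem evalP_foldr_and (l : List (Form I)) :
    evalP v (l.foldr Form.and Form.top) ↔ ∀ χ ∈ l, evalP v χ := by
  induction l with
  | nil => simp
  | cons a l ih => simp [ih]

theorem isClopen_evalP : IsClopen {b : Form I → Bool | evalP (fun χ => b χ = true) φ} := by
  have basic (χ : Form I) : IsClopen {b : Form I → Bool | b χ = true} :=
    (isClopen_discrete {true}).preimage (continuous_apply χ)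
  induction φ with
  | atom n => exact basic (.atom n)
  | bot => exact isClopen_empty
  | neg φ ih => exact ih.compl
  | or φ ψ ih₁ ih₂ => exact ih₁.union ih₂
  | box G hG φ => exact basic (.box G hG φ)

/-- Compactness of classical propositional logic. -/
theorem exists_tautology_of_entails {Γ : Set (Form I)} {φ : Form I}
    (h : ∀ v, (∀ ψ ∈ Γ, evalP v ψ) → evalP v φ) :
    ∃ l : List (Form I), (∀ ψ ∈ l, ψ ∈ Γ) ∧
      Tautology ((l.foldr Form.and Form.top).imp φ) := by
  have hempty : {b : Form I → Bool | evalP (fun χ => b χ = true) φ.neg} ∩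
      ⋂ ψ : Γ, {b : Form I → Bool | evalP (fun χ => b χ = true) ψ} = ∅ := by
    ext b
    simp only [Set.mem_inter_iff, Set.mem_iInter, Set.mem_ofPred_eq, Set.mem_empty_iff_false,
      iff_false, not_and, evalP_neg]
    exact fun hb hΓ => hb (h _ fun ψ hψ => hΓ ⟨ψ, hψ⟩)
  obtain ⟨t, ht⟩ := (isClopen_evalP φ.neg).isClosed.isCompact.elim_finite_subfamily_closed _
    (fun ψ : Γ => (isClopen_evalP ψ.1).isClosed) hempty
  refine ⟨t.toList.map Subtype.val, by simp +contextual, fun v => ?_⟩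
  have hb : (fun χ => (decide (v χ)) = true) = v := by simp
  have hv : (fun χ => decide (v χ)) ∉ _ := Set.eq_empty_iff_forall_notMem.1 ht _
  simp only [Set.mem_inter_iff, Set.mem_iInter, Set.mem_ofPred_eq, evalP_neg, not_and, hb] at hv
  rw [evalP_imp, evalP_foldr_and]
  intro hl
  by_contra hφ
  exact hv hφ fun ψ hψ => hl _ (by simpa using hψ)

end Propositional

section Deduction
variable {I : Type} {Ax : Set (Form I)}

theorem deduces_of_prv_foldr {Γ : Set (Form I)} {l : List (Form I)} {φ : Form I}
    (hl : ∀ ψ ∈ l, ψ ∈ Γ ∨ Prv Ax ψ) (h : Prv Ax ((l.foldr Form.and Form.top).imp φ)) :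
    Deduces Ax Γ φ := by
  induction l generalizing φ with
  | nil => exact ⟨[], by simp, h⟩
  | cons a l ih =>
    have hcurry : Prv Ax ((l.foldr Form.and Form.top).imp (a.imp φ)) :=
      .mp (.taut fun v => by simp; tauto) h
    obtain ⟨l', hl', h'⟩ := ih (fun ψ hψ => hl ψ (List.mem_cons_of_mem _ hψ)) hcurry
    rcases hl a List.mem_cons_self with ha | ha
    · exact ⟨a :: l', by simpa using ⟨ha, hl'⟩, .mp (.taut fun v => by simp; tauto) h'⟩
    · exact ⟨l', hl', .mp (.mp (.taut fun v => by simp; tauto) h') ha⟩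

/-- Valuations verifying every theorem: the maximal consistent sets of the logic. -/
abbrev ThmVal (Ax : Set (Form I)) : Type :=
  { v : Form I → Prop // ∀ θ, Prv Ax θ → evalP v θ }

theorem deduces_of_forall_thmVal {Γ : Set (Form I)} {φ : Form I}
    (h : ∀ v : ThmVal Ax, (∀ ψ ∈ Γ, evalP v.1 ψ) → evalP v.1 φ) : Deduces Ax Γ φ := by
  obtain ⟨l, hl, ht⟩ := exists_tautology_of_entails (Γ := Γ ∪ {θ | Prv Ax θ}) (φ := φ)
    fun v hv => h ⟨v, fun θ hθ => hv θ (.inr hθ)⟩ fun ψ hψ => hv ψ (.inl hψ)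
  exact deduces_of_prv_foldr hl (.taut ht)

theorem prv_of_forall_thmVal {φ : Form I} (h : ∀ v : ThmVal Ax, evalP v.1 φ) : Prv Ax φ := by
  obtain ⟨l, hl, h⟩ := deduces_of_forall_thmVal (Γ := ∅) fun v _ => h v
  obtain rfl : l = [] := List.eq_nil_iff_forall_not_mem.2 hl
  exact .mp h (.taut fun v => by simp)

end Deduction

section Soundness
variable {I W : Type} {N : I → W → Set (Set W)}

theorem mem_ptwInter_singleton {i : I} {w : W} {X : Set W} :
    X ∈ ptwInter N {i} w ↔ X ∈ N i w := by
  constructor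
  · rintro ⟨Y, hY, rfl⟩
    simpa using hY i
  · exact fun h => ⟨fun _ => X, by simpa using h, by simp⟩

/-- Intersecting a member of `N_G(w)` with supersets of it drawn from some of the `N_i(w)`. -/
theorem mem_ptwInter_of_superset {G K : Finset I} {w : W} {X : Set W} (hGK : G ⊆ K)
    (hX : X ∈ ptwInter N G w) (h : ∀ i ∈ K, ∃ Z ∈ N i w, i ∈ G ∨ X ⊆ Z) :
    X ∈ ptwInter N K w := by
  obtain ⟨Y, hY, hXY⟩ := hX
  choose! Z hZ hXZ using h
  refine ⟨fun i => if i ∈ G then Y i else Z i, fun i hi => ?_, ?_⟩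
  · by_cases hiG : i ∈ G
    · simpa [hiG] using hY i hiG
    · simpa [hiG] using hZ i hi
  · apply subset_antisymm
    · refine Set.subset_iInter₂ fun i hi => ?_
      by_cases hiG : i ∈ G
      · simpa [hiG, hXY] using Set.biInter_subset_of_mem (t := Y) (s := (G : Set I)) hiG
      · simpa [hiG] using (hXZ i hi).resolve_left hiG
    · rw [hXY]
      refine Set.subset_iInter₂ fun i hi => ?_
      exact (Set.iInter₂_subset i (hGK hi)).trans (by simp [hi])

theorem satN_iff_evalP (V : ℕ → Set W) (φ : Form I) (w : W) :
    satN N V φ w ↔ evalP (fun χ => satN N V χ w) φ := by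
  induction φ with
  | atom n => rfl
  | bot => rfl
  | neg φ ih => exact not_congr ih
  | or φ ψ ih₁ ih₂ => exact or_congr ih₁ ih₂
  | box G hG φ => rfl

variable [DecidableEq I]

theorem satN_baseAx (V : ℕ → Set W) {χ : Form I} (hχ : χ ∈ BaseAx I) (w : W) :
    satN N V χ w := by
  rcases hχ with ((hχ | hχ) | hχ) | hχ
  · obtain ⟨G, H, hG, hH, φ, ψ, hGH, rfl⟩ := hχ
    rw [satN_iff_evalP]
    simp only [evalP_imp, evalP_and, evalP_box]
    rintro ⟨⟨Y, hY, hYφ⟩, Z, hZ, hZψ⟩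
    have hH' : ∀ i ∈ H, i ∉ G := fun i hi hiG => Finset.disjoint_left.1 hGH hiG hi
    refine ⟨fun i => if i ∈ G then Y i else Z i, fun i hi => ?_, ?_⟩
    · by_cases hiG : i ∈ G
      · simpa [hiG] using hY i hiG
      · simpa [hiG] using hZ i ((Finset.mem_union.1 hi).resolve_left hiG)
    · have hand : {u | satN N V (φ.and ψ) u} = {u | satN N V φ u} ∩ {u | satN N V ψ u} := by
        ext u
        simp [Form.and, satN]
      rw [hand, hYφ, hZψ, Finset.set_biInter_inter]
      congr 1
      · exact Set.iInter₂_congr fun i hi => by simp [hi]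
      · exact Set.iInter₂_congr fun i hi => by simp [hH' i hi]
  · obtain ⟨G, H, hG, hH, rfl⟩ := hχ
    rw [satN_iff_evalP]
    simp only [evalP_imp, evalP_box]
    rintro ⟨Y, hY, hYt⟩
    have htop : {u | satN N V Form.top u} = Set.univ := by
      ext u
      simp [Form.top, satN]
    refine ⟨Y, fun i hi => hY i (Finset.mem_union_left _ hi), ?_⟩
    rw [htop] at hYt ⊢
    rw [Finset.set_biInter_inter] at hYt
    exact subset_antisymm (hYt.subset.trans Set.inter_subset_left) (Set.subset_univ _)
  · obtain ⟨G, H, J, hG, hH, hJ, φ, rfl⟩ := hχ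
    rw [satN_iff_evalP]
    simp only [evalP_imp, evalP_box, evalP_and]
    rintro ⟨hφ, Z, hZ, hZφ⟩
    refine mem_ptwInter_of_superset Finset.subset_union_left hφ fun i hi => ?_
    have hi' := Finset.mem_union_left J hi
    exact ⟨Z i, hZ i hi', .inr (hZφ.subset.trans (Set.iInter₂_subset i hi'))⟩
  · obtain ⟨G, H, hG, hH, φ, ψ, rfl⟩ := hχ
    rw [satN_iff_evalP]
    simp only [evalP_imp, evalP_box, evalP_and]
    rintro ⟨hφ, Z, hZ, hZφ⟩
    refine mem_ptwInter_of_superset Finset.subset_union_left hφ fun i hi => ?_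
    rcases Finset.mem_union.1 hi with hi | hi
    · obtain ⟨Y, hY, -⟩ := hφ
      exact ⟨Y i, hY i hi, .inl hi⟩
    · have hsub : {u | satN N V φ u} ⊆ {u | satN N V (φ.or ψ) u} := fun u hu => .inl hu
      exact ⟨Z i, hZ i hi, .inr ((hsub.trans hZφ.subset).trans (Set.iInter₂_subset i hi))⟩

theorem sat_cheapAx {nec conec pax cop : I → Prop} {M : NbhModel I}
    (hM : CheapFrame nec conec pax cop M) {χ : Form I}
    (hχ : χ ∈ CheapAx I nec conec pax cop) (w : M.W) : M.sat w χ := by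
  have htop : {u | satN M.N M.V Form.top u} = Set.univ := by
    ext u
    simp [Form.top, satN]
  obtain ⟨hnec, hconec, hpax, hcop⟩ := hM
  obtain ⟨i, ⟨hi, rfl⟩ | ⟨hi, rfl⟩ | ⟨hi, rfl⟩ | ⟨hi, rfl⟩⟩ := hχ <;>
    simp only [NbhModel.sat, satN, htop, mem_ptwInter_singleton]
  exacts [hnec i hi w, hconec i hi w, hpax i hi w, hcop i hi w]

theorem NbhModel.sat_of_prv {I : Type} {M : NbhModel I} {Ax : Set (Form I)}
    (hAx : ∀ χ ∈ Ax, ∀ w, M.sat w χ) {φ : Form I} (h : Prv Ax φ) (w : M.W) : M.sat w φ := by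
  induction h generalizing w with
  | taut h => exact (satN_iff_evalP _ _ _).2 (h _)
  | ax h => exact hAx _ h w
  | mp _ _ ih₁ ih₂ => exact (ih₁ w).resolve_left (not_not_intro (ih₂ w))
  | @re φ ψ G hG _ ih =>
    have hset : {u | satN M.N M.V φ u} = {u | satN M.N M.V ψ u} := by
      ext u
      have hu := ih u
      rwa [NbhModel.sat, satN_iff_evalP, evalP_iff, ← satN_iff_evalP, ← satN_iff_evalP] at hu
    rw [NbhModel.sat, satN_iff_evalP, evalP_iff, evalP_box, evalP_box]
    simp only [satN, hset]

theorem NbhModel.semConseq_of_deduces {I : Type} {C : NbhModel I → Prop} {Ax : Set (Form I)}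
    (hAx : ∀ M, C M → ∀ χ ∈ Ax, ∀ w, M.sat w χ) {Γ : Set (Form I)} {φ : Form I}
    (h : Deduces Ax Γ φ) : SemConseq C Γ φ := by
  obtain ⟨l, hl, h⟩ := h
  intro M hM w hw
  have hprv := M.sat_of_prv (hAx M hM) h w
  rw [NbhModel.sat, satN_iff_evalP, evalP_imp, evalP_foldr_and, ← satN_iff_evalP] at hprv
  exact hprv fun ψ hψ => (satN_iff_evalP _ _ _).1 (hw ψ (hl ψ hψ))

end Soundness

section Boxes
variable {I : Type} [DecidableEq I] {Ax : Set (Form I)} (v : ThmVal Ax)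

/-- `□_G φ` holds at `v`, with the nonemptiness of `G` part of the claim. -/
def ThmVal.Box (G : Finset I) (φ : Form I) : Prop :=
  ∃ hG : G.Nonempty, v.1 (.box G hG φ)

variable {v}

omit [DecidableEq I] in
theorem ThmVal.Box.congr {G : Finset I} {φ ψ : Form I} (h : v.Box G φ)
    (hφψ : ∀ u : ThmVal Ax, evalP u.1 φ ↔ evalP u.1 ψ) : v.Box G ψ := by
  obtain ⟨hG, h⟩ := h
  have hprv : Prv Ax (φ.iff ψ) := prv_of_forall_thmVal fun u => by simpa using hφψ u
  have := v.2 _ (.re G hG hprv)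
  rw [evalP_iff] at this
  exact ⟨hG, this.1 h⟩

variable (hAx : BaseAx I ⊆ Ax)
include hAx

theorem ThmVal.Box.and {G H : Finset I} {φ ψ : Form I} (hφ : v.Box G φ) (hψ : v.Box H ψ)
    (hGH : Disjoint G H) : v.Box (G ∪ H) (φ.and ψ) := by
  obtain ⟨hG, hφ⟩ := hφ
  obtain ⟨hH, hψ⟩ := hψ
  have := v.2 _ (.ax (hAx (.inl (.inl (.inl ⟨G, H, hG, hH, φ, ψ, hGH, rfl⟩)))))
  rw [evalP_imp, evalP_and] at this
  exact ⟨_, this ⟨hφ, hψ⟩⟩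

theorem ThmVal.Box.top_anti {G K : Finset I} (h : v.Box K Form.top) (hG : G.Nonempty)
    (hGK : G ⊆ K) : v.Box G Form.top := by
  obtain ⟨hK, h⟩ := h
  have := v.2 _ (.ax (hAx (.inl (.inl (.inr ⟨G, K, hG, hK, rfl⟩)))))
  rw [evalP_imp] at this
  simp only [Finset.union_eq_right.2 hGK] at this
  exact ⟨_, this h⟩

theorem ThmVal.Box.convex {G H J : Finset I} {φ : Form I} (h₁ : v.Box G φ) (h₂ : v.Box J φ)
    (hGH : G ⊆ H) (hHJ : H ⊆ J) : v.Box H φ := by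
  obtain ⟨hG, h₁⟩ := h₁
  obtain ⟨hJ, h₂⟩ := h₂
  have := v.2 _ (.ax (hAx (.inl (.inr ⟨G, H, J, hG, hG.mono hGH, hJ, φ, rfl⟩))))
  rw [evalP_imp, evalP_and] at this
  simp only [Finset.union_eq_right.2 hGH, Finset.union_eq_right.2 hHJ] at this
  exact ⟨_, this ⟨h₁, h₂⟩⟩

theorem ThmVal.Box.union {G H : Finset I} {φ χ : Form I} (hφ : v.Box G φ) (hχ : v.Box H χ)
    (hφχ : ∀ u : ThmVal Ax, evalP u.1 φ → evalP u.1 χ) : v.Box (G ∪ H) φ := by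
  obtain ⟨hG, hφ⟩ := hφ
  obtain ⟨hH, hor⟩ := hχ.congr (ψ := φ.or χ) fun u => by simpa using hφχ u
  have := v.2 _ (.ax (hAx (.inr ⟨G, H, hG, hH, φ, χ, rfl⟩)))
  rw [evalP_imp, evalP_and] at this
  exact ⟨_, this ⟨hφ, hor⟩⟩

theorem ThmVal.Box.biUnion {G₀ K : Finset I} {ψ : Form I} {G : I → Finset I} {φ : I → Form I}
    (h : v.Box G₀ ψ) (hK : ∀ i ∈ K, v.Box (G i) (φ i))
    (hψ : ∀ i ∈ K, ∀ u : ThmVal Ax, evalP u.1 ψ → evalP u.1 (φ i)) :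
    v.Box (G₀ ∪ K.biUnion G) ψ := by
  induction K using Finset.induction_on with
  | empty => simpa using h
  | insert a K _ ih =>
    simp only [Finset.forall_mem_insert] at hK hψ
    have := (ih hK.2 hψ.2).union hAx hK.1 hψ.1
    rwa [Finset.biUnion_insert, Finset.union_comm (G a), ← Finset.union_assoc]

/-- Boxes over pairwise disjoint groups combine into one box over their union. -/
theorem ThmVal.exists_box_biUnion {S : Finset (Finset I × Form I)} (hS : S.Nonempty)
    (hbox : ∀ c ∈ S, v.Box c.1 c.2)
    (hdisj : ∀ c ∈ S, ∀ d ∈ S, c ≠ d → Disjoint c.1 d.1) :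
    ∃ χ, v.Box (S.biUnion Prod.fst) χ ∧
      ∀ u : ThmVal Ax, evalP u.1 χ ↔ ∀ c ∈ S, evalP u.1 c.2 := by
  induction hS using Finset.Nonempty.cons_induction with
  | singleton c => exact ⟨c.2, by simpa using hbox, by simp⟩
  | cons c S hc _ ih =>
    simp only [Finset.forall_mem_cons] at hbox hdisj
    obtain ⟨χ, hχ, hχS⟩ := ih hbox.2 fun d hd e he => (hdisj.2 d hd).2 e he
    refine ⟨c.2.and χ, ?_, fun u => by simp [hχS]⟩
    rw [Finset.cons_eq_insert, Finset.biUnion_insert]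
    refine hbox.1.and hAx hχ ((Finset.disjoint_biUnion_right _ _ _).2 fun d hd => ?_)
    exact hdisj.1.2 d hd fun h => hc (h ▸ hd)

end Boxes

section Canonical
variable {I : Type} {Ax : Set (Form I)}

/-- Canonical worlds: each maximal consistent set is copied once for every assignment of a set
of agents to each pair of a group and a formula. -/
abbrev CanonWorld (Ax : Set (Form I)) : Type :=
  ThmVal Ax × (Finset I → Form I → Set I)

/-- Agent `i`'s share in a box `□_G φ`; the shares of the members of `G` meet exactly in the
truth set of `φ`. -/
def canonShare (Ax : Set (Form I)) (i : I) (G : Finset I) (φ : Form I) : Set (CanonWorld Ax) :=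
  { u | evalP u.1.1 φ ∨ (i ∉ u.2 G φ ∧ ∃ j ∈ G, j ∈ u.2 G φ) }

/-- The canonical neighbourhoods: agents' shares in the boxes true at the world. -/
def canonN (i : I) (w : CanonWorld Ax) : Set (Set (CanonWorld Ax)) :=
  { X | ∃ G φ, i ∈ G ∧ w.1.Box G φ ∧ X = canonShare Ax i G φ }

theorem iInter_canonShare {G : Finset I} (hG : G.Nonempty) (φ : Form I) :
    ⋂ i ∈ G, canonShare Ax i G φ = {u | evalP u.1.1 φ} := by
  ext u
  simp only [Set.mem_iInter, canonShare, Set.mem_ofPred_eq]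
  refine ⟨fun h => ?_, fun h i _ => .inl h⟩
  obtain ⟨i, hi⟩ := hG
  rcases h i hi with h' | ⟨-, j, hj, hju⟩
  · exact h'
  · exact (h j hj).resolve_right fun hn => hn.1 hju

variable [DecidableEq I]

theorem mem_ptwInter_canonN (hAx : BaseAx I ⊆ Ax) {w : CanonWorld Ax} {K : Finset I}
    (hK : K.Nonempty) {ψ : Form I} :
    {u : CanonWorld Ax | evalP u.1.1 ψ} ∈ ptwInter canonN K w ↔ w.1.1 (.box K hK ψ) := by
  refine ⟨?_, fun h => ⟨fun i => canonShare Ax i K ψ, fun i hi => ⟨K, ψ, hi, ⟨hK, h⟩, rfl⟩,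
    (iInter_canonShare hK ψ).symm⟩⟩
  rintro ⟨Y, hY, hYψ⟩
  suffices h : w.1.Box K ψ from h.2
  have hY' : ∀ i, ∃ G φ, i ∈ K → i ∈ G ∧ w.1.Box G φ ∧ Y i = canonShare Ax i G φ := by
    intro i
    by_cases hi : i ∈ K
    · obtain ⟨G, φ, h⟩ := hY i hi
      exact ⟨G, φ, fun _ => h⟩
    · exact ⟨∅, .bot, fun h => absurd h hi⟩
  choose G φ hGφ using hY'
  have hmem (u : CanonWorld Ax) :
      evalP u.1.1 ψ ↔ ∀ i ∈ K, u ∈ canonShare Ax i (G i) (φ i) := by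
    rw [← Set.mem_ofPred_eq (p := fun u : CanonWorld Ax => evalP u.1.1 ψ), hYψ]
    simp only [Set.mem_iInter]
    exact forall₂_congr fun i hi => by rw [(hGφ i hi).2.2]
  -- the agents whose chosen box is chosen by its whole group
  let C := K.filter fun i => ∀ j ∈ G i, j ∈ K ∧ G j = G i ∧ φ j = φ i
  have hψ (u : ThmVal Ax) : evalP u.1 ψ ↔ ∀ i ∈ K, evalP u.1 (φ i) := by
    simpa [canonShare] using hmem (u, fun _ _ => ∅)
  have hψC (u : ThmVal Ax) (hu : ∀ i ∈ C, evalP u.1 (φ i)) : evalP u.1 ψ := by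
    refine (hmem (u, fun H χ => {j | ¬ (j ∈ K ∧ G j = H ∧ φ j = χ)})).2 fun i hi => ?_
    by_cases hiC : i ∈ C
    · exact .inl (hu i hiC)
    · refine .inr ⟨fun h => h ⟨hi, rfl, rfl⟩, ?_⟩
      by_contra hall
      exact hiC (Finset.mem_filter.2
        ⟨hi, fun j hj => not_not.1 fun hn => hall ⟨j, hj, hn⟩⟩)
  have hsub {G₀ : Finset I} : K ⊆ G₀ ∪ K.biUnion G := fun i hi =>
    Finset.mem_union_right _ (Finset.mem_biUnion.2 ⟨i, hi, (hGφ i hi).1⟩)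
  have hbig {G₀ : Finset I} (h : w.1.Box G₀ ψ) : w.1.Box (G₀ ∪ K.biUnion G) ψ :=
    h.biUnion hAx (fun i hi => (hGφ i hi).2.1) fun i hi u hu => (hψ u).1 hu i hi
  rcases C.eq_empty_or_nonempty with hC | hC
  · have htop (u : ThmVal Ax) : evalP u.1 ψ := hψC u (by simp [hC])
    obtain ⟨i, hi⟩ := id hK
    have hi' : w.1.Box (G i) ψ := (hGφ i hi).2.1.congr fun u =>
      iff_of_true ((hψ u).1 (htop u) i hi) (htop u)
    have hall : w.1.Box _ Form.top := (hbig hi').congr fun u => iff_of_true (htop u) (evalP_top _)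
    exact (hall.top_anti hAx hK hsub).congr fun u => iff_of_true (evalP_top _) (htop u)
  · obtain ⟨χ, hχ, hχC⟩ := ThmVal.exists_box_biUnion (v := w.1) hAx
      (hC.image fun i => (G i, φ i)) (by
        simp only [Finset.forall_mem_image]
        exact fun i hi => (hGφ i (Finset.mem_filter.1 hi).1).2.1) (by
        simp only [Finset.forall_mem_image]
        intro i hi j hj hne
        refine Finset.disjoint_left.2 fun k hki hkj => hne ?_
        obtain ⟨-, h₁, h₂⟩ := (Finset.mem_filter.1 hi).2 k hki
        obtain ⟨-, h₃, h₄⟩ := (Finset.mem_filter.1 hj).2 k hkj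
        rw [← h₁, ← h₂, h₃, h₄])
    simp only [Finset.forall_mem_image] at hχC
    have hχψ : w.1.Box _ ψ := hχ.congr fun u => ⟨fun h => hψC u ((hχC u).1 h),
      fun h => (hχC u).2 fun _ hi => (hψ u).1 h _ (Finset.mem_filter.1 hi).1⟩
    refine hχψ.convex hAx (hbig hχψ) ?_ hsub
    simp only [Finset.biUnion_subset, Finset.forall_mem_image]
    exact fun i hi j hj => ((Finset.mem_filter.1 hi).2 j hj).1

theorem satN_canonN (hAx : BaseAx I ⊆ Ax) (φ : Form I) (u : CanonWorld Ax) :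
    satN canonN (fun n => {u : CanonWorld Ax | u.1.1 (.atom n)}) φ u ↔ evalP u.1.1 φ := by
  induction φ generalizing u with
  | atom n => rfl
  | bot => rfl
  | neg φ ih => exact not_congr (ih u)
  | or φ ψ ih₁ ih₂ => exact or_congr (ih₁ u) (ih₂ u)
  | box G hG φ ih =>
    simp only [satN, ih]
    exact mem_ptwInter_canonN hAx hG

theorem univ_mem_canonN (hAx : BaseAx I ⊆ Ax) (i : I) (w : CanonWorld Ax) :
    Set.univ ∈ canonN i w ↔ w.1.1 (.box {i} (Finset.singleton_nonempty i) Form.top) := by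
  rw [← mem_ptwInter_canonN hAx, mem_ptwInter_singleton]
  simp

theorem empty_mem_canonN (hAx : BaseAx I ⊆ Ax) (i : I) (w : CanonWorld Ax) :
    ∅ ∈ canonN i w ↔ w.1.1 (.box {i} (Finset.singleton_nonempty i) Form.bot) := by
  rw [← mem_ptwInter_canonN hAx, mem_ptwInter_singleton]
  simp

end Canonical

/-- For every choice of a subset of the four
frame-condition/axiom pairs for each i ∈ I, the base logic plus the
corresponding axioms is sound and strongly complete w.r.t. the class of all
models satisfying the corresponding frame conditions. -/
theorem cheap_sound_complete (I : Type) [DecidableEq I]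
    (nec conec pax cop : I → Prop) :
    SoundComplete (BaseAx I ∪ CheapAx I nec conec pax cop)
      (CheapFrame nec conec pax cop) := by
  intro Γ φ
  refine ⟨NbhModel.semConseq_of_deduces fun M hM χ hχ w => ?_, fun h => ?_⟩
  · exact hχ.elim (fun hχ => satN_baseAx _ hχ w) fun hχ => sat_cheapAx hM hχ w
  · refine deduces_of_forall_thmVal fun v hv => ?_
    have hAx : BaseAx I ⊆ BaseAx I ∪ CheapAx I nec conec pax cop := Set.subset_union_left
    refine (satN_canonN hAx φ (v, fun _ _ => ∅)).1
      (h ⟨CanonWorld _, ⟨(v, fun _ _ => ∅)⟩, canonN, _⟩ ?_ _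
        fun ψ hψ => (satN_canonN hAx ψ _).2 (hv ψ hψ))
    have hcheap {χ : Form I} (hχ : χ ∈ CheapAx I nec conec pax cop)
        (w : CanonWorld (BaseAx I ∪ CheapAx I nec conec pax cop)) : evalP w.1.1 χ :=
      w.1.2 χ (.ax (.inr hχ))
    refine ⟨fun i hi w => ?_, fun i hi w => ?_, fun i hi w => ?_, fun i hi w => ?_⟩
    · exact (univ_mem_canonN hAx i w).2 (hcheap ⟨i, .inl ⟨hi, rfl⟩⟩ w)
    · exact (univ_mem_canonN hAx i w).not.2 (hcheap ⟨i, .inr (.inl ⟨hi, rfl⟩)⟩ w)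
    · exact (empty_mem_canonN hAx i w).not.2 (hcheap ⟨i, .inr (.inr (.inl ⟨hi, rfl⟩))⟩ w)
    · exact (empty_mem_canonN hAx i w).2 (hcheap ⟨i, .inr (.inr (.inr ⟨hi, rfl⟩))⟩ w)
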